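/- arXiv:2207.02793 — 5 statements merged into one kernel-verified Lean document; each statement's English description precedes it below -/
import Mathlib

section
/- Let d > 0 and let g : ℂ → ℂ be analytic on the open horizontal strip {z : |Im z| < d}. Assume there is M ≥ 0 such that for every a ∈ (−d, d) the function y ↦ g(y + i a) is integrable over ℝ with ∫_ℝ |g(y + i a)| dy ≤ M, and that ∫_{−d}^{d} |g(A + i a)| da → 0 as A → ±∞ (A real). Then for every ζ > 0 the series ∑_{j ∈ ℤ} g(jζ) converges absolutely and the error of the infinite trapezoid rule satisfies |∫_ℝ g(y) dy − ζ ∑_{j ∈ ℤ} g(jζ)| ≤ 2M · exp(−2πd/ζ) / (1 − exp(−2πd/ζ)). -/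
open MeasureTheory Filter Complex

/-- A holomorphic function at the centre of a disc is bounded by its `L¹` mean over the disc. -/
theorem enorm_center_le_lintegral_ball {f : ℂ → ℂ} {c : ℂ} {R : ℝ} (hR : 0 < R)
    (hf : DifferentiableOn ℂ f (Metric.ball c R)) :
    ENNReal.ofReal (Real.pi * R ^ 2) * ‖f c‖ₑ ≤ ∫⁻ z in Metric.ball c R, ‖f z‖ₑ := by
  set G : ℂ → ENNReal := (Metric.ball c R).indicator (fun z => ‖f z‖ₑ) with hG
  have hGm : Measurable G := by
    have : ContinuousOn (fun z => ‖f z‖ₑ) (Metric.ball c R) := hf.continuousOn.enorm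
    classical
    rw [hG, ← Set.piecewise_eq_indicator]
    exact this.measurable_piecewise continuousOn_const measurableSet_ball
  have hmean : ∀ r ∈ Set.Ioo 0 R, ENNReal.ofReal (2 * Real.pi) * ‖f c‖ₑ ≤
      ∫⁻ θ in Set.Ioo (-Real.pi) Real.pi, G (c + Complex.polarCoord.symm (r, θ)) := by
    intro r hr
    have hsub : Metric.closedBall c |r| ⊆ Metric.ball c R := by
      rw [abs_of_pos hr.1]; exact Metric.closedBall_subset_ball hr.2
    have h1 := (hf.mono hsub).diffContOnCl_ball (Set.Subset.refl _) |>.circleAverage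
    have hmap : ∀ θ : ℝ, c + Complex.polarCoord.symm (r, θ) = circleMap c r θ := by
      intro θ
      simp [circleMap, Complex.exp_mul_I]
    have h2 : ∀ θ : ℝ, G (c + Complex.polarCoord.symm (r, θ)) = ‖f (circleMap c r θ)‖ₑ := by
      intro θ
      rw [hmap, hG, Set.indicator_of_mem]
      exact hsub (Metric.sphere_subset_closedBall (circleMap_mem_sphere' c r θ))
    simp_rw [h2]
    have h3 : ∫ θ in Set.Ioo (-Real.pi) Real.pi, f (circleMap c r θ) = (2 * Real.pi : ℝ) • f c := by
      rw [← integral_Ioc_eq_integral_Ioo, ← intervalIntegral.integral_of_le (by linarith [Real.pi_pos])]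
      have hp : Function.Periodic (fun θ => f (circleMap c r θ)) (2 * Real.pi) := fun θ => by
        simp only [periodic_circleMap c r θ]
      have := hp.intervalIntegral_add_eq (-Real.pi) 0
      rw [show -Real.pi + 2 * Real.pi = Real.pi by ring, zero_add] at this
      rw [this, ← h1, Real.circleAverage_def, smul_inv_smul₀ (by positivity)]
    calc _ = ‖∫ θ in Set.Ioo (-Real.pi) Real.pi, f (circleMap c r θ)‖ₑ := by
          rw [h3, enorm_smul, Real.enorm_eq_ofReal (by positivity)]
      _ ≤ _ := enorm_integral_le_lintegral_enorm _
  have hr : ∫⁻ r in Set.Ioo 0 R, ENNReal.ofReal r = ENNReal.ofReal (R ^ 2 / 2) := by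
    rw [← ofReal_integral_eq_lintegral_ofReal, ← integral_Ioc_eq_integral_Ioo,
      ← intervalIntegral.integral_of_le hR.le, integral_id]
    · simp
    · exact (continuous_id.integrableOn_Icc).mono_set Set.Ioo_subset_Icc_self
    · exact (ae_restrict_mem measurableSet_Ioo).mono fun x hx => hx.1.le
  have hpol : Measurable fun p : ℝ × ℝ => G (c + Complex.polarCoord.symm p) := by
    refine hGm.comp ?_
    simp only [Complex.polarCoord_symm_apply]
    fun_prop
  calc ENNReal.ofReal (Real.pi * R ^ 2) * ‖f c‖ₑ
      = ∫⁻ r in Set.Ioo 0 R, ENNReal.ofReal r * (ENNReal.ofReal (2 * Real.pi) * ‖f c‖ₑ) := by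
        rw [lintegral_mul_const _ (by fun_prop), hr, ← mul_assoc, ← ENNReal.ofReal_mul (by positivity)]
        congr 2; ring
    _ ≤ ∫⁻ r in Set.Ioo 0 R, ENNReal.ofReal r *
          ∫⁻ θ in Set.Ioo (-Real.pi) Real.pi, G (c + Complex.polarCoord.symm (r, θ)) :=
        setLIntegral_mono' measurableSet_Ioo fun r hr => by gcongr; exact hmean r hr
    _ ≤ ∫⁻ r in Set.Ioi 0, ENNReal.ofReal r *
          ∫⁻ θ in Set.Ioo (-Real.pi) Real.pi, G (c + Complex.polarCoord.symm (r, θ)) :=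
        lintegral_mono_set Set.Ioo_subset_Ioi_self
    _ = ∫⁻ p in polarCoord.target, ENNReal.ofReal p.1 • G (c + Complex.polarCoord.symm p) := by
        rw [polarCoord_target, Measure.volume_eq_prod, ← Measure.prod_restrict, lintegral_prod]
        · refine lintegral_congr fun r => ?_
          simp only [smul_eq_mul]
          rw [lintegral_const_mul]
          exact hpol.comp (by fun_prop)
        · exact ((by fun_prop : Measurable fun p : ℝ × ℝ => ENNReal.ofReal p.1).mul hpol).aemeasurable
    _ = ∫⁻ z, G (c + z) := Complex.lintegral_comp_polarCoord_symm fun z => G (c + z)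
    _ = ∫⁻ z, G z := lintegral_add_left_eq_self G c
    _ = _ := lintegral_indicator measurableSet_ball _

/-- A function holomorphic in a horizontal strip, with uniformly bounded `L¹` norms on horizontal
lines, is integrable over the strip. -/
theorem lintegral_strip_lt_top {d M : ℝ} {g : ℂ → ℂ}
    (hg : ∀ z : ℂ, |z.im| < d → DifferentiableAt ℂ g z)
    (hint : ∀ a : ℝ, a ∈ Set.Ioo (-d) d →
      Integrable (fun y : ℝ => g (y + a * Complex.I)) ∧
      (∫ y : ℝ, ‖g (y + a * Complex.I)‖) ≤ M) :
    ∫⁻ z in {z : ℂ | |z.im| < d}, ‖g z‖ₑ < ⊤ := by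
  set S : Set ℂ := {z : ℂ | |z.im| < d} with hS
  have hSm : MeasurableSet S := (isOpen_lt (by fun_prop) (by fun_prop)).measurableSet
  set G : ℂ → ENNReal := S.indicator (fun z => ‖g z‖ₑ) with hG
  have hGm : Measurable G := by
    have : ContinuousOn (fun z => ‖g z‖ₑ) S :=
      ContinuousOn.enorm fun z hz => (hg z hz).continuousAt.continuousWithinAt
    classical
    rw [hG, ← Set.piecewise_eq_indicator]
    exact this.measurable_piecewise continuousOn_const hSm
  rw [← lintegral_indicator hSm, ← hG,
    ← (volume_preserving_equiv_real_prod.symm).lintegral_comp_emb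
      measurableEquivRealProd.symm.measurableEmbedding, Measure.volume_eq_prod,
    lintegral_prod_symm (fun p => G (measurableEquivRealProd.symm p))
      (hGm.comp measurableEquivRealProd.symm.measurable).aemeasurable]
  have hle : ∀ y : ℝ, ∫⁻ x : ℝ, G (measurableEquivRealProd.symm (x, y)) ≤
      (Set.Ioo (-d) d).indicator (fun _ => ENNReal.ofReal M) y := by
    intro y
    have hxy : ∀ x : ℝ, measurableEquivRealProd.symm (x, y) = x + y * I := fun x => by
      simp [measurableEquivRealProd, Complex.ext_iff]
    simp_rw [hxy]
    by_cases hy : y ∈ Set.Ioo (-d) d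
    · rw [Set.indicator_of_mem hy]
      have : ∀ x : ℝ, G (x + y * I) = ‖g (x + y * I)‖ₑ := fun x => by
        rw [hG, Set.indicator_of_mem]; simpa [hS, abs_lt] using hy
      simp_rw [this]
      rw [← ofReal_integral_norm_eq_lintegral_enorm (hint y hy).1]
      exact ENNReal.ofReal_le_ofReal (hint y hy).2
    · have : ∀ x : ℝ, G (x + y * I) = 0 := fun x => by
        rw [hG, Set.indicator_of_notMem]; simpa [hS, abs_lt] using hy
      simp [this]
  refine (lintegral_mono hle).trans_lt ?_
  rw [lintegral_indicator_const measurableSet_Ioo]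
  simp [ENNReal.mul_lt_top_iff]

/-- A holomorphic function integrable over a strip is bounded, on the integer translates of any
compact box in the strip, by a summable sequence. -/
theorem exists_summable_bound {d : ℝ} {g : ℂ → ℂ}
    (hg : ∀ z : ℂ, |z.im| < d → DifferentiableAt ℂ g z)
    (hfin : ∫⁻ z in {z : ℂ | |z.im| < d}, ‖g z‖ₑ < ⊤) {b : ℝ} (hb : b < d) (L : ℝ) :
    ∃ u : ℤ → ℝ, Summable u ∧
      ∀ (n : ℤ) (z : ℂ), |z.re| ≤ L → |z.im| ≤ b → ‖g (z + n)‖ ≤ u n := by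
  set R := d - b with hR
  have hR0 : 0 < R := sub_pos.2 hb
  set S : Set ℂ := {z : ℂ | |z.im| < d} with hS
  have hSm : MeasurableSet S := (isOpen_lt (by fun_prop) (by fun_prop)).measurableSet
  set T : ℤ → Set ℂ := fun m => {z : ℂ | ⌊z.re⌋ = m} ∩ S with hT
  have hTm : ∀ m, MeasurableSet (T m) := fun m =>
    ((measurableSet_singleton m).preimage (by fun_prop : Measurable fun z : ℂ => ⌊z.re⌋)).inter hSm
  set v : ℤ → ENNReal := fun m => ∫⁻ z in T m, ‖g z‖ₑ with hv
  have hd : Pairwise (Function.onFun Disjoint T) := fun i j hij =>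
    Set.disjoint_left.2 fun z hi hj => hij (hi.1.symm.trans hj.1)
  have hvsum : ∑' m, v m ≠ ⊤ := by
    rw [hv, ← lintegral_iUnion hTm hd]
    exact ((lintegral_mono_set (Set.iUnion_subset fun m => Set.inter_subset_right)).trans_lt
      hfin).ne
  obtain ⟨N, hN⟩ := exists_nat_ge (L + R + 1)
  have hvt : ∀ m, v m ≠ ⊤ := ENNReal.ne_top_of_tsum_ne_top hvsum
  refine ⟨fun n => (Real.pi * R ^ 2)⁻¹ * ∑ k ∈ Finset.Icc (-N : ℤ) N, (v (n + k)).toReal,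
    (summable_sum fun k _ => ?_).mul_left _, fun n z hre him => ?_⟩
  · exact (ENNReal.summable_toReal hvsum).comp_injective (add_left_injective k)
  have hball : Metric.ball (z + n) R ⊆ ⋃ k ∈ Finset.Icc (-N : ℤ) N, T (n + k) := by
    intro w hw
    rw [mem_ball_iff_norm] at hw
    have h1 := (abs_re_le_norm _).trans_lt hw
    have h2 := (abs_im_le_norm _).trans_lt hw
    simp only [sub_re, add_re, intCast_re, sub_im, add_im, intCast_im, add_zero] at h1 h2
    rw [abs_lt] at h1 h2
    rw [abs_le] at hre him
    simp only [Set.mem_iUnion]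
    refine ⟨⌊w.re⌋ - n, ?_, by simp, ?_⟩
    · have h3 := Int.floor_le w.re
      have h4 := Int.lt_floor_add_one w.re
      rw [Finset.mem_Icc]
      constructor
      · have : ((-N : ℤ) : ℝ) ≤ ((⌊w.re⌋ - n : ℤ) : ℝ) := by push_cast; linarith
        exact_mod_cast this
      · have : ((⌊w.re⌋ - n : ℤ) : ℝ) ≤ ((N : ℤ) : ℝ) := by push_cast; linarith
        exact_mod_cast this
    · rw [hS, Set.mem_ofPred_eq, abs_lt]
      constructor <;> linarith
  have hballS : Metric.ball (z + n) R ⊆ S := hball.trans <|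
    Set.iUnion₂_subset fun k _ => Set.inter_subset_right
  have hmain : ENNReal.ofReal (Real.pi * R ^ 2) * ‖g (z + n)‖ₑ ≤
      ∑ k ∈ Finset.Icc (-N : ℤ) N, v (n + k) :=
    (enorm_center_le_lintegral_ball hR0
      fun w hw => (hg w (hballS hw)).differentiableWithinAt).trans <|
    (lintegral_mono_set hball).trans <| (lintegral_biUnion_finset (t := fun k => T (n + k))
      (fun i _ j _ hij => hd fun h => hij (add_left_cancel h)) (fun k _ => hTm _) _).le
  beta_reduce
  rw [inv_mul_eq_div, le_div_iff₀ (by positivity), mul_comm, ← ENNReal.toReal_sum fun k _ => hvt _]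
  have := ENNReal.toReal_mono (ENNReal.sum_ne_top.2 fun k _ => hvt (n + k)) hmain
  simpa [ENNReal.toReal_ofReal (by positivity : 0 ≤ Real.pi * R ^ 2)] using this

/-- Shift of a horizontal line of integration for a function that decays along the integer
translates of a vertical segment. -/
theorem integral_eq_integral_add_mul_I {d b : ℝ} {h : ℂ → ℂ}
    (hh : ∀ z : ℂ, |z.im| < d → DifferentiableAt ℂ h z) (hb : |b| < d)
    (h0 : Integrable fun x : ℝ => h x) (h1 : Integrable fun x : ℝ => h (x + b * I))
    {u : ℤ → ℝ} (hu : Tendsto u cofinite (nhds 0))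
    (hbd : ∀ (n : ℤ) (y : ℝ), |y| ≤ |b| → ‖h (n + y * I)‖ ≤ u n) :
    ∫ x : ℝ, h x = ∫ x : ℝ, h (x + b * I) := by
  have hside : ∀ n : ℤ, ‖∫ y in (0 : ℝ)..b, h (n + y * I)‖ ≤ u n * |b| := fun n => by
    have := intervalIntegral.norm_integral_le_of_norm_le_const (a := (0 : ℝ)) (b := b)
      (f := fun y : ℝ => h (n + y * I)) (C := u n) fun y hy => hbd n y ?_
    · simpa using this
    · rw [Set.mem_uIoc] at hy
      rcases hy with hy | hy
      · exact abs_le_abs_of_nonneg hy.1.le hy.2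
      · exact abs_le_abs_of_nonpos hy.2 hy.1.le
  have htop : Tendsto (fun n : ℕ => (n : ℤ)) atTop cofinite :=
    Nat.cofinite_eq_atTop ▸ Nat.cast_injective.tendsto_cofinite
  have hbot : Tendsto (fun n : ℕ => -(n : ℤ)) atTop cofinite :=
    neg_injective.tendsto_cofinite.comp htop
  have hlim : ∀ φ : ℕ → ℤ, Tendsto φ atTop cofinite →
      Tendsto (fun n => ∫ y in (0 : ℝ)..b, h (φ n + y * I)) atTop (nhds 0) := fun φ hφ =>
    squeeze_zero_norm (fun n => hside (φ n)) (by simpa using (hu.comp hφ).mul_const |b|)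
  have hcast : Tendsto (fun n : ℕ => (n : ℝ)) atTop atTop := tendsto_natCast_atTop_atTop
  have hneg : Tendsto (fun n : ℕ => -(n : ℝ)) atTop atBot := tendsto_neg_atTop_atBot.comp hcast
  have l0 := intervalIntegral_tendsto_integral h0 hneg hcast
  have l1 := intervalIntegral_tendsto_integral h1 hneg hcast
  have key := ((l0.sub l1).add ((hlim _ htop).const_mul I)).sub ((hlim _ hbot).const_mul I)
  have hz : ∀ n : ℕ, (((∫ x in (-(n : ℝ))..n, h x) - ∫ x in (-(n : ℝ))..n, h (x + b * I)) +
      I * ∫ y in (0 : ℝ)..b, h (((n : ℤ) : ℂ) + y * I)) -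
      I * ∫ y in (0 : ℝ)..b, h (((-(n : ℤ) : ℤ) : ℂ) + y * I) = 0 := fun n => by
    have := integral_boundary_rect_eq_zero_of_differentiableOn h (-(n : ℝ) : ℝ) (n + b * I)
      fun z hz => (hh z ?_).differentiableWithinAt
    · simpa using this
    · have := hz.2
      simp [Set.mem_uIcc] at this
      refine lt_of_le_of_lt ?_ hb
      rcases this with hy | hy
      · exact abs_le_abs_of_nonneg hy.1 hy.2
      · exact abs_le_abs_of_nonpos hy.2 hy.1
  simp only [hz] at key
  have := tendsto_nhds_unique key tendsto_const_nhds
  simpa [sub_eq_zero] using this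

/-- Exponential decay of the Fourier coefficients of a function holomorphic in a strip. -/
theorem norm_fourier_le_mul_exp {d M : ℝ} (hd : 0 < d) {g : ℂ → ℂ}
    (hg : ∀ z : ℂ, |z.im| < d → DifferentiableAt ℂ g z)
    (hint : ∀ a : ℝ, a ∈ Set.Ioo (-d) d →
      Integrable (fun y : ℝ => g (y + a * Complex.I)) ∧
      (∫ y : ℝ, ‖g (y + a * Complex.I)‖) ≤ M) (n : ℤ) :
    ‖FourierTransform.fourier (fun x : ℝ => g x) (n : ℝ)‖ ≤
      M * Real.exp (-2 * Real.pi * d * |(n : ℝ)|) := by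
  set h : ℂ → ℂ := fun z => cexp (-2 * Real.pi * n * I * z) * g z with hh
  have hF : FourierTransform.fourier (fun x : ℝ => g x) (n : ℝ) = ∫ x : ℝ, h x := by
    rw [Real.fourier_real_eq_integral_exp_smul]
    refine integral_congr_ae (.of_forall fun x => ?_)
    simp only [hh, smul_eq_mul]
    congr 2
    push_cast
    ring
  have hnorm : ∀ z : ℂ, ‖h z‖ = Real.exp (2 * Real.pi * n * z.im) * ‖g z‖ := fun z => by
    rw [hh, norm_mul, norm_exp]
    congr 2
    simp [mul_re, mul_im]
  have hhd : ∀ z : ℂ, |z.im| < d → DifferentiableAt ℂ h z := fun z hz =>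
    DifferentiableAt.mul (by fun_prop) (hg z hz)
  have hhi : ∀ a ∈ Set.Ioo (-d) d, Integrable fun x : ℝ => h (x + a * I) := fun a ha => by
    refine ((hint a ha).1.norm.const_mul (Real.exp (2 * Real.pi * n * a))).mono' ?_
      (.of_forall fun x => ?_)
    · exact Continuous.aestronglyMeasurable (by fun_prop) |>.mul (hint a ha).1.1
    · rw [hnorm]; simp
  have hshift : ∀ b : ℝ, |b| < d →
      ‖FourierTransform.fourier (fun x : ℝ => g x) (n : ℝ)‖ ≤
        M * Real.exp (2 * Real.pi * n * b) := fun b hb => by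
    obtain ⟨u, hu, hub⟩ := exists_summable_bound hg (lintegral_strip_lt_top hg hint) hb 0
    have hu' : Tendsto (fun m => Real.exp (2 * Real.pi * |(n : ℝ)| * |b|) * u m) cofinite
        (nhds 0) := by simpa using hu.tendsto_cofinite_zero.const_mul _
    rw [hF, integral_eq_integral_add_mul_I hhd hb (by simpa using hhi 0 (by simpa using hd))
      (hhi b (abs_lt.1 hb)) hu']
    · calc _ ≤ ∫ x : ℝ, ‖h (x + b * I)‖ := norm_integral_le_integral_norm _
        _ = Real.exp (2 * Real.pi * n * b) * ∫ x : ℝ, ‖g (x + b * I)‖ := by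
            rw [← integral_const_mul]
            simp [hnorm]
        _ ≤ _ := by
            rw [mul_comm M]
            gcongr
            exact (hint b (abs_lt.1 hb)).2
    · intro m y hy
      rw [hnorm]
      have hexp : 2 * Real.pi * n * y ≤ 2 * Real.pi * |(n : ℝ)| * |b| :=
        calc 2 * Real.pi * n * y ≤ |2 * Real.pi * n * y| := le_abs_self _
          _ = 2 * Real.pi * |(n : ℝ)| * |y| := by
              rw [abs_mul, abs_mul, abs_of_pos Real.two_pi_pos]
          _ ≤ _ := by gcongr
      refine mul_le_mul (Real.exp_le_exp.2 (by simpa using hexp)) ?_ (norm_nonneg _)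
        (Real.exp_pos _).le
      rw [add_comm]
      exact hub m (y * I) (by simp) (by simpa using hy)
  have hlim : Tendsto (fun t : ℝ => M * Real.exp (-2 * Real.pi * (t * d) * |(n : ℝ)|))
      (nhdsWithin 1 (Set.Iio 1)) (nhds (M * Real.exp (-2 * Real.pi * d * |(n : ℝ)|))) := by
    have : Continuous fun t : ℝ => M * Real.exp (-2 * Real.pi * (t * d) * |(n : ℝ)|) := by
      fun_prop
    simpa using (this.tendsto 1).mono_left nhdsWithin_le_nhds
  refine ge_of_tendsto hlim ?_
  filter_upwards [Ioo_mem_nhdsLT (show (0 : ℝ) < 1 by norm_num)] with t ht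
  have htd : t * d < d := mul_lt_of_lt_one_left hd ht.2
  have htd0 : 0 < t * d := mul_pos ht.1 hd
  rcases le_total 0 (n : ℝ) with hn | hn
  · refine (hshift (-(t * d)) (by rwa [abs_neg, abs_of_pos htd0])).trans_eq ?_
    rw [abs_of_nonneg hn]; ring_nf
  · refine (hshift (t * d) (by rwa [abs_of_pos htd0])).trans_eq ?_
    rw [abs_of_nonpos hn]; ring_nf

/-- The error bound for the infinite trapezoid rule with step `1`. -/
theorem trapezoid_unit_step_error {d M : ℝ} (hd : 0 < d) {g : ℂ → ℂ}
    (hg : ∀ z : ℂ, |z.im| < d → DifferentiableAt ℂ g z)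
    (hint : ∀ a : ℝ, a ∈ Set.Ioo (-d) d →
      Integrable (fun y : ℝ => g (y + a * Complex.I)) ∧
      (∫ y : ℝ, ‖g (y + a * Complex.I)‖) ≤ M) :
    Summable (fun j : ℤ => ‖g j‖) ∧
      ‖(∫ y : ℝ, g y) - ∑' j : ℤ, g j‖ ≤
        2 * M * Real.exp (-2 * Real.pi * d) / (1 - Real.exp (-2 * Real.pi * d)) := by
  have hfin := lintegral_strip_lt_top hg hint
  have hcont : Continuous fun x : ℝ => g x := continuous_iff_continuousAt.2 fun x =>
    (hg x (by simpa using hd)).continuousAt.comp continuous_ofReal.continuousAt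
  set q := Real.exp (-2 * Real.pi * d) with hq
  have hq0 : 0 ≤ q := (Real.exp_pos _).le
  have hq1 : q < 1 := by
    rw [hq, Real.exp_lt_one_iff]
    nlinarith [Real.pi_pos, mul_pos Real.pi_pos hd]
  set F : ℤ → ℂ := fun n => FourierTransform.fourier (fun x : ℝ => g x) (n : ℝ) with hF
  have hFle : ∀ n : ℤ, ‖F n‖ ≤ M * q ^ n.natAbs := fun n => by
    refine (norm_fourier_le_mul_exp hd hg hint n).trans_eq ?_
    rw [hq, ← Real.exp_nat_mul, Nat.cast_natAbs]
    push_cast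
    congr 2; ring
  have hgeo : HasSum (fun n : ℕ => M * q ^ (n + 1)) (M * q / (1 - q)) := by
    have := (hasSum_geometric_of_lt_one hq0 hq1).mul_left (M * q)
    rw [← div_eq_mul_inv] at this
    exact this.congr_fun fun n => by ring
  have hpos : ∀ n : ℕ, ‖F (n + 1)‖ ≤ M * q ^ (n + 1) := fun n => by
    exact_mod_cast hFle (n + 1 : ℕ)
  have hneg : ∀ n : ℕ, ‖F (-(n + 1))‖ ≤ M * q ^ (n + 1) := fun n => by
    exact_mod_cast (Int.natAbs_neg (n + 1 : ℕ)) ▸ hFle (-(n + 1 : ℕ))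
  have hsp : Summable fun n : ℕ => F (n + 1) := .of_norm_bounded hgeo.summable hpos
  have hsn : Summable fun n : ℕ => F (-(n + 1)) := .of_norm_bounded hgeo.summable hneg
  have hsum : Summable F := .of_add_one_of_neg_add_one hsp hsn
  have hloc : ∀ K : TopologicalSpace.Compacts ℝ, Summable fun n : ℤ =>
      ‖((⟨fun x : ℝ => g x, hcont⟩ : C(ℝ, ℂ)).comp (ContinuousMap.addRight (n : ℝ))).restrict K‖ := by
    intro K
    obtain ⟨L, hL⟩ := K.isCompact.isBounded.exists_norm_le
    obtain ⟨u, hu, hub⟩ := exists_summable_bound hg hfin hd L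
    refine hu.abs.of_nonneg_of_le (fun _ => norm_nonneg _) fun n => ?_
    refine (ContinuousMap.norm_le _ (abs_nonneg _)).2 fun x => ?_
    have := (hub n (x : ℝ) (by simpa using hL x x.2) (by simp)).trans (le_abs_self _)
    rw [← ofReal_intCast, ← ofReal_add] at this
    exact this
  have hsumg : Summable (fun j : ℤ => ‖g j‖) := by
    obtain ⟨u, hu, hub⟩ := exists_summable_bound hg hfin hd 0
    exact hu.of_nonneg_of_le (fun _ => norm_nonneg _) fun n => by
      simpa using hub n 0 (by simp) (by simp)
  refine ⟨hsumg, ?_⟩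
  have hpoisson : ∑' j : ℤ, g j = ∑' n : ℤ, F n := by
    simpa using Real.tsum_eq_tsum_fourier hloc hsum 0
  have hF0 : F 0 = ∫ y : ℝ, g y := by
    simp [hF, Real.fourier_real_eq_integral_exp_smul]
  rw [hpoisson, tsum_of_add_one_of_neg_add_one hsp hsn, hF0]
  calc _ = ‖(∑' n : ℕ, F (n + 1)) + ∑' n : ℕ, F (-(n + 1))‖ := by
        rw [← norm_neg]; congr 1; ring
    _ ≤ M * q / (1 - q) + M * q / (1 - q) :=
        norm_add_le_of_le (tsum_of_norm_bounded hgeo hpos) (tsum_of_norm_bounded hgeo hneg)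
    _ = _ := by ring

/-- Error bound for the infinite trapezoid rule for a function analytic in the
strip `{z : |Im z| < d}` with `H¹`-norm bounded by `2M`. -/
theorem infinite_trapezoid_rule_error
    (d : ℝ) (hd : 0 < d) (g : ℂ → ℂ)
    (hg : ∀ z : ℂ, |z.im| < d → DifferentiableAt ℂ g z)
    (M : ℝ) (hM : 0 ≤ M)
    (hint : ∀ a : ℝ, a ∈ Set.Ioo (-d) d →
      Integrable (fun y : ℝ => g (y + a * Complex.I)) ∧
      (∫ y : ℝ, ‖g (y + a * Complex.I)‖) ≤ M)
    (hdecay_top : Tendsto (fun A : ℝ => ∫ a in (-d)..d, ‖g (A + a * Complex.I)‖)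
      atTop (nhds 0))
    (hdecay_bot : Tendsto (fun A : ℝ => ∫ a in (-d)..d, ‖g (A + a * Complex.I)‖)
      atBot (nhds 0)) :
    ∀ ζ : ℝ, 0 < ζ →
      Summable (fun j : ℤ => ‖g ((j * ζ : ℝ) : ℂ)‖) ∧
      ‖(∫ y : ℝ, g (y : ℂ)) - ζ * ∑' j : ℤ, g ((j * ζ : ℝ) : ℂ)‖ ≤
        2 * M * Real.exp (-2 * Real.pi * d / ζ) /
          (1 - Real.exp (-2 * Real.pi * d / ζ)) := by
  intro ζ hζ
  have him : ∀ z : ℂ, |z.im| < d / ζ ↔ |((ζ : ℂ) * z).im| < d := fun z => by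
    rw [im_ofReal_mul, abs_mul, abs_of_pos hζ, lt_div_iff₀' hζ]
  have hline : ∀ a y : ℝ, (ζ : ℂ) * (y + a * I) = ((ζ * y : ℝ) : ℂ) + ((ζ * a : ℝ) : ℂ) * I :=
    fun a y => by push_cast; ring
  have hscaled := trapezoid_unit_step_error (d := d / ζ) (M := M / ζ) (div_pos hd hζ)
    (g := fun z => g (ζ * z))
    (fun z hz => (hg _ ((him z).1 hz)).comp z (by fun_prop)) (fun a ha => by
      have ha' : ζ * a ∈ Set.Ioo (-d) d := by
        rw [Set.mem_Ioo, ← abs_lt, abs_mul, abs_of_pos hζ, ← lt_div_iff₀' hζ]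
        exact abs_lt.2 ha
      obtain ⟨h1, h2⟩ := hint _ ha'
      simp only [hline]
      refine ⟨h1.comp_mul_left' hζ.ne', ?_⟩
      rw [Measure.integral_comp_mul_left (fun y : ℝ => ‖g (y + ((ζ * a : ℝ) : ℂ) * I)‖),
        abs_of_pos (inv_pos.2 hζ), smul_eq_mul, inv_mul_eq_div]
      gcongr)
  have hpt : ∀ j : ℤ, ((j * ζ : ℝ) : ℂ) = ζ * j := fun j => by push_cast; ring
  simp only [hpt]
  refine ⟨hscaled.1, ?_⟩
  have hint_scaled : ∫ y : ℝ, g y = ζ * ∫ y : ℝ, g (ζ * y) := by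
    have := Measure.integral_comp_mul_left (fun y : ℝ => g y) ζ
    push_cast at this
    rw [this, abs_of_pos (inv_pos.2 hζ), real_smul, ofReal_inv,
      mul_inv_cancel_left₀ (ofReal_ne_zero.2 hζ.ne')]
  rw [hint_scaled, ← mul_sub, norm_mul, norm_real, Real.norm_of_nonneg hζ.le]
  refine (mul_le_mul_of_nonneg_left hscaled.2 hζ.le).trans_eq ?_
  rw [← mul_div_assoc (-2 * Real.pi) d ζ]
  field_simp
end

section
/- Let n ≥ 1 and N > 1 be integers, ζ > 0, a ∈ ℝ with e^{iaζ} ≠ 1, and let g : ℝ → ℂ be n times continuously differentiable. Define (Δ_ζ g)(ξ) = g(ξ+ζ) − g(ξ), Δ_ζⁿ its n-fold iterate, and G_n(ξ) := sup_{η ∈ [ξ − ζ, ξ + (n+1)ζ]} |g⁽ⁿ⁾(η)|, and assume G_n is integrable on ℝ. Then |(ζ/(e^{iaζ}−1)ⁿ) ∑_{j ≥ N} e^{−iajζ} (Δ_ζⁿ g)(jζ)| ≤ (ζ/|e^{iaζ}−1|)ⁿ ∫_{Nζ}^{+∞} G_n(ξ) dξ and |(ζ/(e^{iaζ}−1)ⁿ)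 ∑_{j ≤ −N} e^{−iajζ} (Δ_ζⁿ g)(jζ)| ≤ (ζ/|e^{iaζ}−1|)ⁿ ∫_{−∞}^{−Nζ} G_n(ξ) dξ. -/
open Set MeasureTheory

/-- Forward difference operator with step `ζ` on functions `ℝ → ℂ`. -/
def fdiffStep (ζ : ℝ) (g : ℝ → ℂ) : ℝ → ℂ := fun ξ => g (ξ + ζ) - g ξ

lemma contDiff_fdiffStep {ζ : ℝ} {g : ℝ → ℂ} {n : ℕ} (hg : ContDiff ℝ n g) :
    ContDiff ℝ n (fdiffStep ζ g) := by
  unfold fdiffStep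
  fun_prop

lemma iteratedDeriv_fdiffStep {ζ : ℝ} {g : ℝ → ℂ} {n : ℕ} (hg : ContDiff ℝ n g) :
    iteratedDeriv n (fdiffStep ζ g) = fdiffStep ζ (iteratedDeriv n g) := by
  funext η
  have hshift : ContDiff ℝ n (fun ξ => g (ξ + ζ)) := by fun_prop
  change iteratedDeriv n ((fun ξ => g (ξ + ζ)) - g) η = _
  rw [iteratedDeriv_sub hshift.contDiffAt hg.contDiffAt, iteratedDeriv_comp_add_const]
  rfl

/-- The `n`-th difference is bounded by `ζ ^ n` times a bound on the `n`-th derivative. -/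
lemma norm_iterate_fdiffStep_le {ζ : ℝ} (hζ : 0 ≤ ζ) (x : ℝ) {n : ℕ} {g : ℝ → ℂ} {C : ℝ}
    (hg : ContDiff ℝ n g)
    (hC : ∀ η ∈ Icc x (x + n * ζ), ‖iteratedDeriv n g η‖ ≤ C) :
    ‖(fdiffStep ζ)^[n] g x‖ ≤ ζ ^ n * C := by
  induction n generalizing g C with
  | zero => simpa using hC x (by simp)
  | succ n ih =>
    have hgn : ContDiff ℝ n g := hg.of_le (by exact_mod_cast n.le_succ)
    rw [Function.iterate_succ_apply, pow_succ, mul_assoc]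
    refine ih (contDiff_fdiffStep hgn) fun η hη => ?_
    rw [iteratedDeriv_fdiffStep hgn]
    have hdiff : Differentiable ℝ (iteratedDeriv n g) :=
      hg.differentiable_iteratedDeriv n (by exact_mod_cast n.lt_succ_self)
    have hmvt := (convex_Icc η (η + ζ)).norm_image_sub_le_of_norm_deriv_le (C := C)
      (fun y _ => hdiff y) (fun y hy => ?_) (left_mem_Icc.2 (by linarith))
      (right_mem_Icc.2 (by linarith))
    · simpa [fdiffStep, abs_of_nonneg hζ, mul_comm] using hmvt
    · rw [← iteratedDeriv_succ]
      refine hC y ⟨hη.1.trans hy.1, hy.2.trans ?_⟩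
      have := hη.2
      push_cast
      linarith

/-- A series whose terms are dominated by an integrable function on disjoint cells of measure `ζ`
is bounded by an integral of that function. -/
lemma mul_norm_tsum_le_setIntegral {ι E : Type*} [Countable ι] [NormedAddCommGroup E]
    {ζ c : ℝ} (hζ : 0 < ζ) (hc : 0 ≤ c) {u : ι → E} {I : ι → Set ℝ} {S : Set ℝ} {G : ℝ → ℝ}
    (hG : Integrable G) (hG0 : ∀ ξ, 0 ≤ G ξ) (hI : ∀ i, MeasurableSet (I i))
    (hdisj : Pairwise (Function.onFun Disjoint I)) (hvol : ∀ i, volume (I i) = ENNReal.ofReal ζ)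
    (hsub : ∀ i, I i ⊆ S) (hu : ∀ i, ∀ ξ ∈ I i, ‖u i‖ ≤ c * G ξ) :
    ζ * ‖∑' i, u i‖ ≤ c * ∫ ξ in S, G ξ := by
  have hsum := hasSum_integral_iUnion hI hdisj hG.integrableOn
  have hterm (i : ι) : ‖u i‖ ≤ ζ⁻¹ * (c * ∫ ξ in I i, G ξ) := by
    rw [le_inv_mul_iff₀ hζ, ← integral_const_mul]
    have hfin : volume (I i) ≠ ⊤ := by simp [hvol]
    have h := setIntegral_mono_on (integrableOn_const hfin) (hG.const_mul c).integrableOn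
      (hI i) (hu i)
    simpa [measureReal_def, hvol, hζ.le] using h
  have h := tsum_of_norm_bounded ((hsum.mul_left c).mul_left ζ⁻¹) hterm
  rw [le_inv_mul_iff₀ hζ] at h
  refine h.trans (mul_le_mul_of_nonneg_left ?_ hc)
  exact setIntegral_mono_set hG.integrableOn (.of_forall hG0)
    (LE.le.eventuallyLE (iUnion_subset hsub))

lemma norm_exp_neg_I_mul_int (a ζ : ℝ) (j : ℤ) :
    ‖Complex.exp (-Complex.I * a * j * ζ)‖ = 1 := by
  rw [Complex.norm_exp]
  simp

lemma norm_div_pow_mul_le {ζ B : ℝ} (hζ : 0 ≤ ζ) {w T : ℂ} {n : ℕ}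
    (h : ζ * ‖T‖ ≤ ζ ^ n * B) : ‖(ζ : ℂ) / w ^ n * T‖ ≤ (ζ / ‖w‖) ^ n * B := by
  rw [norm_mul, norm_div, norm_pow, Complex.norm_real, Real.norm_of_nonneg hζ, div_pow,
    div_mul_eq_mul_div, div_mul_eq_mul_div]
  gcongr

/-- Truncation error bounds for the `n`-fold summation-by-parts formula. -/
theorem summation_by_parts_truncation_error
    (n N : ℕ) (hn : 1 ≤ n) (hN : 1 < N) (ζ a : ℝ) (hζ : 0 < ζ)
    (ha : Complex.exp (Complex.I * a * ζ) ≠ 1)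
    (g : ℝ → ℂ) (hg : ContDiff ℝ n g)
    (G : ℝ → ℝ)
    (hG : ∀ ξ : ℝ, G ξ =
      sSup ((fun η => ‖iteratedDeriv n g η‖) '' Icc (ξ - ζ) (ξ + (n + 1) * ζ)))
    (hGint : Integrable G) :
    ‖((ζ : ℂ) / (Complex.exp (Complex.I * a * ζ) - 1) ^ n) *
        ∑' j : {j : ℤ // (N : ℤ) ≤ j},
          Complex.exp (-Complex.I * a * (j : ℤ) * ζ) *
            (fdiffStep ζ)^[n] g ((j : ℤ) * ζ)‖ ≤
      (ζ / ‖Complex.exp (Complex.I * a * ζ) - 1‖) ^ n *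
        ∫ ξ in Ici ((N : ℝ) * ζ), G ξ
    ∧
    ‖((ζ : ℂ) / (Complex.exp (Complex.I * a * ζ) - 1) ^ n) *
        ∑' j : {j : ℤ // j ≤ -(N : ℤ)},
          Complex.exp (-Complex.I * a * (j : ℤ) * ζ) *
            (fdiffStep ζ)^[n] g ((j : ℤ) * ζ)‖ ≤
      (ζ / ‖Complex.exp (Complex.I * a * ζ) - 1‖) ^ n *
        ∫ ξ in Iic (-(N : ℝ) * ζ), G ξ := by
  have hbdd (ξ : ℝ) :
      BddAbove ((fun η => ‖iteratedDeriv n g η‖) '' Icc (ξ - ζ) (ξ + (n + 1) * ζ)) :=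
    isCompact_Icc.bddAbove_image (hg.continuous_iteratedDeriv n le_rfl).norm.continuousOn
  have hG0 (ξ : ℝ) : 0 ≤ G ξ := by
    rw [hG]
    exact Real.sSup_nonneg (by rintro _ ⟨η, -, rfl⟩; exact norm_nonneg _)
  have hterm (j : ℤ) (ξ : ℝ) (h₁ : (j - 1) * ζ ≤ ξ) (h₂ : ξ ≤ (j + 1) * ζ) :
      ‖Complex.exp (-Complex.I * a * j * ζ) * (fdiffStep ζ)^[n] g (j * ζ)‖ ≤ ζ ^ n * G ξ := by
    rw [norm_mul, norm_exp_neg_I_mul_int, one_mul]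
    refine norm_iterate_fdiffStep_le hζ.le _ hg fun η hη => ?_
    rw [hG]
    exact le_csSup (hbdd ξ) ⟨η, ⟨by linarith [hη.1], by linarith [hη.2]⟩, rfl⟩
  have hdisj (b : ℝ) :
      Pairwise (Function.onFun Disjoint fun j : ℤ => Ioc (b + j * ζ) (b + (j + 1) * ζ)) := by
    simpa using pairwise_disjoint_Ioc_add_zsmul b ζ
  have hvol (b : ℝ) (j : ℤ) :
      volume (Ioc (b + j * ζ) (b + (j + 1) * ζ)) = ENNReal.ofReal ζ := by
    rw [Real.volume_Ioc]
    ring_nf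
  constructor
  · refine norm_div_pow_mul_le hζ.le (mul_norm_tsum_le_setIntegral hζ (by positivity) hGint hG0
      (fun _ => measurableSet_Ioc) ((hdisj 0).comp_of_injective Subtype.val_injective)
      (fun j => hvol 0 j) ?_ fun j ξ hξ => hterm j ξ ?_ ?_)
    · rintro ⟨j, hj⟩ ξ hξ
      have hj' : (N : ℝ) ≤ j := by exact_mod_cast hj
      exact (mul_le_mul_of_nonneg_right hj' hζ.le).trans (by simpa using hξ.1.le)
    · linarith [hξ.1]
    · linarith [hξ.2]
  · refine norm_div_pow_mul_le hζ.le (mul_norm_tsum_le_setIntegral hζ (by positivity) hGint hG0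
      (fun _ => measurableSet_Ioc) ((hdisj (-ζ)).comp_of_injective Subtype.val_injective)
      (fun j => hvol (-ζ) j) ?_ fun j ξ hξ => hterm j ξ ?_ ?_)
    · rintro ⟨j, hj⟩ ξ hξ
      have hj' : (j : ℝ) ≤ -N := by exact_mod_cast hj
      have := mul_le_mul_of_nonneg_right hj' hζ.le
      have := hξ.2
      simp only [mem_Iic] at *
      linarith
    · linarith [hξ.1]
    · linarith [hξ.2]
end

section
/- For all a > 0 and b > 0 there exists a constant C > 0 such that for every ξ₁ ∈ ℝ, ∫_{{ξ₂ ∈ ℝ : |ξ₁|/2 ≤ |ξ₂| ≤ 2|ξ₁|}} g_{a,b}(ξ₁, ξ₂) dξ₂ ≤ C · log(2 + |ξ₁|) · (1 + |ξ₁|)^{−1−b}. -/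
open MeasureTheory

/-- Estimate of the integral of the kernel `g_{a,b}` over the annular region
`{|ξ₁|/2 ≤ |ξ₂| ≤ 2|ξ₁|}`. -/
theorem gab_annulus_integral_bound (a b : ℝ) (ha : 0 < a) (hb : 0 < b) :
    ∃ C : ℝ, 0 < C ∧ ∀ ξ₁ : ℝ,
      (∫ ξ₂ in {ξ₂ : ℝ | |ξ₁| / 2 ≤ |ξ₂| ∧ |ξ₂| ≤ 2 * |ξ₁|},
        (1 + |ξ₁ + ξ₂|) ^ (-a) * (1 + |ξ₁|) ^ (-1 - b) * (1 + |ξ₂|) ^ (-(1 : ℝ)))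
      ≤ C * Real.log (2 + |ξ₁|) * (1 + |ξ₁|) ^ (-1 - b) := by
  have hlog : 0 < Real.log 2 := Real.log_pos one_lt_two
  refine ⟨8 / Real.log 2, by positivity, fun x => ?_⟩
  have hx := abs_nonneg x
  set s := {y : ℝ | |x| / 2 ≤ |y| ∧ |y| ≤ 2 * |x|}
  set P := (1 + |x|) ^ (-1 - b)
  have hP : 0 ≤ P := by positivity
  have hs : s ⊆ Set.Icc (-(2 * |x|)) (2 * |x|) := fun y hy => abs_le.1 hy.2
  have hfin : volume (Set.Icc (-(2 * |x|)) (2 * |x|)) ≠ ⊤ := measure_Icc_lt_top.ne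
  have hvol : volume.real s ≤ 4 * |x| := by
    refine (measureReal_mono hs hfin).trans ?_
    rw [Real.volume_real_Icc_of_le (by linarith)]
    linarith
  have hbound : ∀ y ∈ s,
      ‖(1 + |x + y|) ^ (-a) * P * (1 + |y|) ^ (-(1 : ℝ))‖ ≤ P * (1 + |x| / 2)⁻¹ := by
    intro y hy
    rw [Real.norm_of_nonneg (by positivity), Real.rpow_neg_one]
    have h₁ : (1 + |x + y|) ^ (-a) ≤ 1 :=
      Real.rpow_le_one_of_one_le_of_nonpos (by linarith [abs_nonneg (x + y)]) (by linarith)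
    have h₂ : (1 + |y|)⁻¹ ≤ (1 + |x| / 2)⁻¹ := by
      gcongr
      exact hy.1
    exact mul_le_mul (mul_le_of_le_one_left hP h₁) h₂ (by positivity) hP
  have hint := norm_setIntegral_le_of_norm_le_const
    ((measure_mono hs).trans_lt hfin.lt_top) hbound
  calc _ ≤ P * (1 + |x| / 2)⁻¹ * volume.real s := (Real.le_norm_self _).trans hint
    _ ≤ P * (1 + |x| / 2)⁻¹ * (4 * |x|) := by gcongr
    _ = (4 * |x| / (1 + |x| / 2)) * P := by ring
    _ ≤ 8 * P := by
      gcongr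
      rw [div_le_iff₀ (by positivity)]
      linarith
    _ ≤ 8 / Real.log 2 * Real.log (2 + |x|) * P := by
      gcongr
      rw [div_mul_eq_mul_div, le_div_iff₀ hlog]
      gcongr
      linarith
end

section
/- Fix c > 0, ν ∈ (0, 2) with ν ≠ 1, and λ₋ < 0 < λ₊, and define ψ⁰(ξ) = c Γ(−ν) [(−λ₋)^ν − (−λ₋ − iξ)^ν + λ₊^ν − (λ₊ + iξ)^ν] using principal-branch complex powers. Then for every φ ∈ (−π/2, π/2), the limit lim_{ρ → +∞} ψ⁰(ρ e^{iφ}) / ρ^ν exists and equals c_∞(φ) = −2 c Γ(−ν) cos(νπ/2) e^{iνφ}. -/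
open Complex Filter

/-- The KoBoL (CGMY) characteristic exponent (up to a drift term), with
principal-branch complex powers. -/
noncomputable def psi0KoBoL (c ν lm lp : ℝ) (ξ : ℂ) : ℂ :=
  (c : ℂ) * (Real.Gamma (-ν) : ℂ) *
    (((-lm : ℝ) : ℂ) ^ (ν : ℂ) - (((-lm : ℝ) : ℂ) - Complex.I * ξ) ^ (ν : ℂ) +
     ((lp : ℝ) : ℂ) ^ (ν : ℂ) - (((lp : ℝ) : ℂ) + Complex.I * ξ) ^ (ν : ℂ))

/-- Principal powers of affine functions along a ray avoiding the branch cut. -/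
theorem tendsto_const_add_ofReal_mul_cpow_div (a s w : ℂ) (hw : w ∈ slitPlane) :
    Tendsto (fun ρ : ℝ => (a + (ρ : ℂ) * w) ^ s / (ρ : ℂ) ^ s) atTop (nhds (w ^ s)) := by
  have hinv : Tendsto (fun ρ : ℝ => ((ρ : ℂ))⁻¹) atTop (nhds 0) := by
    have := (continuous_ofReal.tendsto 0).comp tendsto_inv_atTop_zero
    simpa [Function.comp_def] using this
  have hlim : Tendsto (fun ρ : ℝ => w + a * (ρ : ℂ)⁻¹) atTop (nhds w) := by
    simpa using (hinv.const_mul a).const_add w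
  have hpow : Tendsto (fun ρ : ℝ => (w + a * (ρ : ℂ)⁻¹) ^ s) atTop (nhds (w ^ s)) :=
    hlim.cpow tendsto_const_nhds hw
  refine hpow.congr' ?_
  filter_upwards [eventually_gt_atTop 0,
    hlim.eventually (isOpen_slitPlane.mem_nhds hw)] with ρ hρ hmem
  have hρ0 : (ρ : ℂ) ≠ 0 := ofReal_ne_zero.mpr hρ.ne'
  have hne := slitPlane_ne_zero hmem
  have hfac : a + (ρ : ℂ) * w = (ρ : ℂ) * (w + a * (ρ : ℂ)⁻¹) := by
    field_simp
    ring
  rw [hfac, cpow_def_of_ne_zero (mul_ne_zero hρ0 hne), cpow_def_of_ne_zero hne,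
    cpow_def_of_ne_zero hρ0, log_ofReal_mul hρ hne, ← exp_sub, ofReal_log hρ.le]
  congr 1
  ring

/-- A constant is negligible compared with a positive power. -/
theorem tendsto_const_div_ofReal_cpow (b : ℂ) {ν : ℝ} (hν : 0 < ν) :
    Tendsto (fun ρ : ℝ => b / (ρ : ℂ) ^ (ν : ℂ)) atTop (nhds 0) := by
  have h := (continuous_ofReal.tendsto 0).comp (tendsto_rpow_neg_atTop hν)
  have h' := h.const_mul b
  simp only [ofReal_zero, mul_zero] at h'
  refine h'.congr' ?_
  filter_upwards [eventually_ge_atTop 0] with ρ hρ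
  simp [Real.rpow_neg hρ, ofReal_cpow hρ, div_eq_mul_inv]

theorem exp_ofReal_mul_I_mem_slitPlane {θ : ℝ} (h₁ : -Real.pi < θ) (h₂ : θ < Real.pi) :
    exp (θ * I) ∈ slitPlane := by
  rw [mem_slitPlane_iff_arg, arg_exp_mul_I,
    (toIocMod_eq_self Real.two_pi_pos).mpr ⟨h₁, by linarith⟩]
  exact ⟨h₂.ne, exp_ne_zero _⟩

theorem exp_ofReal_mul_I_cpow {θ : ℝ} (h₁ : -Real.pi < θ) (h₂ : θ ≤ Real.pi) (s : ℂ) :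
    exp (θ * I) ^ s = exp (θ * I * s) := by
  rw [cpow_def_of_ne_zero (exp_ne_zero _), log_exp (by simpa using h₁) (by simpa using h₂)]

/-- Asymptotics of the KoBoL characteristic exponent along the ray `ρ e^{iφ}`:
`ψ⁰(ρ e^{iφ}) / ρ^ν → −2 c Γ(−ν) cos(νπ/2) e^{iνφ}` as `ρ → +∞`. -/
theorem psi0KoBoL_ray_asymptotics (c ν lm lp : ℝ)
    (hc : 0 < c) (hν1 : 0 < ν) (hν2 : ν < 2) (hν3 : ν ≠ 1)
    (hlm : lm < 0) (hlp : 0 < lp)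
    (φ : ℝ) (hφ1 : -(Real.pi / 2) < φ) (hφ2 : φ < Real.pi / 2) :
    Tendsto
      (fun ρ : ℝ =>
        psi0KoBoL c ν lm lp ((ρ : ℂ) * Complex.exp (Complex.I * φ)) / (ρ : ℂ) ^ (ν : ℂ))
      atTop
      (nhds (-2 * (c : ℂ) * (Real.Gamma (-ν) : ℂ) * (Real.cos (ν * Real.pi / 2) : ℂ) *
        Complex.exp (Complex.I * ν * φ))) := by
  have hpi := Real.pi_pos
  have hminus : exp (((φ - Real.pi / 2 : ℝ) : ℂ) * I) = -I * exp (I * φ) := by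
    rw [show ((φ - Real.pi / 2 : ℝ) : ℂ) * I = -(Real.pi / 2 * I) + I * φ by push_cast; ring,
      exp_add, exp_neg, exp_pi_div_two_mul_I, inv_I]
  have hplus : exp (((φ + Real.pi / 2 : ℝ) : ℂ) * I) = I * exp (I * φ) := by
    rw [show ((φ + Real.pi / 2 : ℝ) : ℂ) * I = Real.pi / 2 * I + I * φ by push_cast; ring,
      exp_add, exp_pi_div_two_mul_I]
  have h₁ := tendsto_const_add_ofReal_mul_cpow_div ((-lm : ℝ) : ℂ) ν _
    (exp_ofReal_mul_I_mem_slitPlane (θ := φ - Real.pi / 2) (by linarith) (by linarith))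
  have h₂ := tendsto_const_add_ofReal_mul_cpow_div (lp : ℂ) ν _
    (exp_ofReal_mul_I_mem_slitPlane (θ := φ + Real.pi / 2) (by linarith) (by linarith))
  rw [exp_ofReal_mul_I_cpow (by linarith) (by linarith), hminus] at h₁
  rw [exp_ofReal_mul_I_cpow (by linarith) (by linarith), hplus] at h₂
  have h₃ := tendsto_const_div_ofReal_cpow (((-lm : ℝ) : ℂ) ^ (ν : ℂ)) hν1
  have h₄ := tendsto_const_div_ofReal_cpow ((lp : ℂ) ^ (ν : ℂ)) hν1
  have h := (((h₃.sub h₁).add h₄).sub h₂).const_mul ((c : ℂ) * (Real.Gamma (-ν) : ℂ))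
  convert h using 2 with ρ
  · rw [psi0KoBoL,
      show ((-lm : ℝ) : ℂ) - I * (ρ * exp (I * φ)) = ((-lm : ℝ) : ℂ) + ρ * (-I * exp (I * φ)) by
        ring,
      show (lp : ℂ) + I * (ρ * exp (I * φ)) = lp + ρ * (I * exp (I * φ)) by ring]
    ring
  · rw [show ((φ - Real.pi / 2 : ℝ) : ℂ) * I * ν = -(ν * Real.pi / 2) * I + I * ν * φ by
        push_cast; ring,
      show ((φ + Real.pi / 2 : ℝ) : ℂ) * I * ν = ν * Real.pi / 2 * I + I * ν * φ by
        push_cast; ring,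
      exp_add, exp_add, ofReal_cos, Complex.cos]
    push_cast
    ring
end

section
/- Let h : ℝ → ℂ be integrable, ω₁ ∈ ℝ, a₁, a₂ ∈ ℝ, and η ∈ ℂ with Im η < ω₁. Then the iterated integral ∫_{a₂}^{+∞} e^{−i y η} ( ∫_ℝ e^{i (y − a₁)(u + iω₁)} h(u) du ) dy is absolutely convergent and equals e^{−i a₂ η} ∫_ℝ e^{i (a₂ − a₁)(u + iω₁)} h(u) / ( i (η − u − iω₁) ) du. -/
open Complex MeasureTheory Set

theorem integrableOn_exp_mul_exp_mul (h : ℝ → ℂ) (hh : Integrable h) (ω₁ a₁ a₂ : ℝ)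
    (η : ℂ) (hη : η.im < ω₁) :
    IntegrableOn
      (fun p : ℝ × ℝ =>
        Complex.exp (-Complex.I * (p.1 : ℂ) * η) *
          (Complex.exp (Complex.I * ((p.1 : ℂ) - (a₁ : ℂ)) *
            ((p.2 : ℂ) + Complex.I * (ω₁ : ℂ))) * h p.2))
      (Ioi a₂ ×ˢ univ) := by
  have hre : (-(ω₁ : ℂ) - Complex.I * η).re < 0 := by simpa using hη
  have hprod := (integrableOn_exp_mul_complex_Ioi hre a₂).mul_prod hh
  have hphase : Continuous fun p : ℝ × ℝ =>
      Complex.exp (a₁ * ω₁) * Complex.exp (((p.1 - a₁) * p.2 : ℝ) * Complex.I) := by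
    fun_prop
  have hint := hprod.bdd_mul (c := ‖Complex.exp (a₁ * ω₁)‖) hphase.aestronglyMeasurable
    (.of_forall fun p => by rw [norm_mul, Complex.norm_exp_ofReal_mul_I, mul_one])
  rw [IntegrableOn, Measure.volume_eq_prod, ← Measure.prod_restrict, Measure.restrict_univ]
  refine hint.congr (.of_forall fun p => ?_)
  simp only [← mul_assoc, ← Complex.exp_add]
  congr 2
  push_cast
  linear_combination (-(p.1 : ℂ) * ω₁ + a₁ * ω₁) * Complex.I_sq

theorem integral_Ioi_exp_mul_exp {η ξ : ℂ} (hξ : η.im < ξ.im) (a₁ a₂ : ℝ) :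
    ∫ y in Ioi a₂, Complex.exp (-Complex.I * (y : ℂ) * η) *
        Complex.exp (Complex.I * ((y : ℂ) - (a₁ : ℂ)) * ξ) =
      Complex.exp (-Complex.I * (a₂ : ℂ) * η) *
        (Complex.exp (Complex.I * ((a₂ : ℂ) - (a₁ : ℂ)) * ξ) / (Complex.I * (η - ξ))) := by
  have hre : (Complex.I * (ξ - η)).re < 0 := by simpa using hξ
  have hsplit (y : ℝ) : Complex.exp (-Complex.I * (y : ℂ) * η) *
        Complex.exp (Complex.I * ((y : ℂ) - (a₁ : ℂ)) * ξ) =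
      Complex.exp (-Complex.I * a₁ * ξ) * Complex.exp (Complex.I * (ξ - η) * y) := by
    simp only [← Complex.exp_add]
    ring_nf
  rw [← mul_div_assoc, hsplit]
  simp_rw [hsplit]
  rw [integral_const_mul, integral_exp_mul_complex_Ioi hre, ← neg_sub ξ η, mul_neg, div_neg,
    neg_div, mul_neg, mul_div_assoc]

/-- Fubini-type exchange used in the derivation of the Laplace transform of the
joint cdf of a Lévy process and its running maximum: the double integral is
absolutely convergent, and the iterated integral
`∫_{a₂}^{∞} e^{−iyη} (∫_ℝ e^{i(y−a₁)(u+iω₁)} h(u) du) dy` equals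
`e^{−ia₂η} ∫_ℝ e^{i(a₂−a₁)(u+iω₁)} h(u) / (i(η − u − iω₁)) du`. -/
theorem iterated_integral_exchange
    (h : ℝ → ℂ) (hh : Integrable h) (ω₁ a₁ a₂ : ℝ)
    (η : ℂ) (hη : η.im < ω₁) :
    IntegrableOn
      (fun p : ℝ × ℝ =>
        Complex.exp (-Complex.I * (p.1 : ℂ) * η) *
          (Complex.exp (Complex.I * ((p.1 : ℂ) - (a₁ : ℂ)) *
            ((p.2 : ℂ) + Complex.I * (ω₁ : ℂ))) * h p.2))
      (Ioi a₂ ×ˢ univ)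
    ∧
    (∫ y in Ioi a₂, Complex.exp (-Complex.I * (y : ℂ) * η) *
        ∫ u : ℝ, Complex.exp (Complex.I * ((y : ℂ) - (a₁ : ℂ)) *
          ((u : ℂ) + Complex.I * (ω₁ : ℂ))) * h u)
      = Complex.exp (-Complex.I * (a₂ : ℂ) * η) *
        ∫ u : ℝ, Complex.exp (Complex.I * ((a₂ : ℂ) - (a₁ : ℂ)) *
            ((u : ℂ) + Complex.I * (ω₁ : ℂ))) * h u /
          (Complex.I * (η - (u : ℂ) - Complex.I * (ω₁ : ℂ))) := by
  have hint := integrableOn_exp_mul_exp_mul h hh ω₁ a₁ a₂ η hη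
  refine ⟨hint, ?_⟩
  rw [IntegrableOn, Measure.volume_eq_prod, ← Measure.prod_restrict, Measure.restrict_univ] at hint
  simp_rw [← integral_const_mul]
  rw [integral_integral_swap hint]
  refine integral_congr_ae (.of_forall fun u => ?_)
  have hξ : η.im < ((u : ℂ) + Complex.I * ω₁).im := by simpa using hη
  simp only [← mul_assoc]
  rw [integral_mul_const, integral_Ioi_exp_mul_exp hξ, sub_sub]
  ring
end
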